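/- Let W ∈ ℝ^{m×n}, let A, B ∈ ℝ^{n×l} be such that BBᵀ is invertible, let k ∈ ℕ, let L_B ∈ ℝ^{n×n} be any invertible matrix satisfying BBᵀ = L_B L_Bᵀ, and set M := W A Bᵀ (BBᵀ)^{-1} L_B. Then the minimum of ‖W A − W' B‖_F² over all W' ∈ ℝ^{m×n} with rank(W') ≤ k equals ‖W A‖_F² − ‖M‖_F² + Σ_{i>k} σ_i(M)². -/

import Mathlib

open Matrix

noncomputable section

/-- The squared Frobenius norm of a real matrix. -/
def frobSq {m n : ℕ} (M : Matrix (Fin m) (Fin n) ℝ) : ℝ := ∑ i, ∑ j, (M i j) ^ 2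

/-- The m×n rectangular diagonal matrix whose (i,i) entry (0-based) is `s (i+1)`,
so that `s` gives the 1-indexed diagonal values `s 1, s 2, …`. -/
def rectDiag (m n : ℕ) (s : ℕ → ℝ) : Matrix (Fin m) (Fin n) ℝ :=
  Matrix.of fun i j => if (i : ℕ) = (j : ℕ) then s ((i : ℕ) + 1) else 0

/-- `IsSVD m n W U s V` says that `W = U Σ Vᵀ` is a singular value decomposition of `W`:
`U` and `V` are orthogonal and `s 1 ≥ s 2 ≥ ⋯ ≥ 0` are the (1-indexed) singular values
of `W` arranged in nonincreasing order along the rectangular diagonal `Σ`. -/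
structure IsSVD (m n : ℕ) (W : Matrix (Fin m) (Fin n) ℝ)
    (U : Matrix (Fin m) (Fin m) ℝ) (s : ℕ → ℝ) (V : Matrix (Fin n) (Fin n) ℝ) : Prop where
  orthU : Uᵀ * U = 1
  orthV : Vᵀ * V = 1
  nonneg : ∀ i, 0 ≤ s i
  mono : ∀ i j, i ≤ j → s j ≤ s i
  decomp : W = U * rectDiag m n s * Vᵀ

/-- The rank-`k` truncation `U Σₖ Vᵀ` of a singular value decomposition,
retaining only the top-`k` singular values `s 1, …, s k`. -/
def svdTrunc (m n k : ℕ) (U : Matrix (Fin m) (Fin m) ℝ) (s : ℕ → ℝ)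
    (V : Matrix (Fin n) (Fin n) ℝ) : Matrix (Fin m) (Fin n) ℝ :=
  U * rectDiag m n (fun i => if i ≤ k then s i else 0) * Vᵀ

theorem frobSq_eq_trace {m n : ℕ} (M : Matrix (Fin m) (Fin n) ℝ) :
    frobSq M = (M * Mᵀ).trace := by
  simp [frobSq, Matrix.trace, Matrix.mul_apply, sq]

theorem frobSq_nonneg {m n : ℕ} (M : Matrix (Fin m) (Fin n) ℝ) : 0 ≤ frobSq M :=
  Finset.sum_nonneg fun _ _ => Finset.sum_nonneg fun _ _ => sq_nonneg _

theorem frobSq_sub {m n : ℕ} (M N : Matrix (Fin m) (Fin n) ℝ) :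
    frobSq (M - N) = frobSq M - 2 * (M * Nᵀ).trace + frobSq N := by
  have h : (N * Mᵀ).trace = (M * Nᵀ).trace := by
    rw [← Matrix.trace_transpose, Matrix.transpose_mul, Matrix.transpose_transpose]
  simp only [frobSq_eq_trace, Matrix.transpose_sub, Matrix.sub_mul, Matrix.mul_sub,
    Matrix.trace_sub, h]
  ring

theorem frobSq_orthogonal_mul_mul {m n : ℕ} {U : Matrix (Fin m) (Fin m) ℝ}
    {V : Matrix (Fin n) (Fin n) ℝ} (hU : Uᵀ * U = 1) (hV : Vᵀ * V = 1)
    (D : Matrix (Fin m) (Fin n) ℝ) : frobSq (U * D * Vᵀ) = frobSq D := by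
  have h : U * D * Vᵀ * (U * D * Vᵀ)ᵀ = U * (D * (Vᵀ * V) * Dᵀ * Uᵀ) := by
    simp only [Matrix.transpose_mul, Matrix.transpose_transpose, Matrix.mul_assoc]
  rw [frobSq_eq_trace, frobSq_eq_trace, h, hV, Matrix.mul_one, Matrix.trace_mul_comm,
    Matrix.mul_assoc, hU, Matrix.mul_one]

theorem rectDiag_mul_transpose (m n : ℕ) (s : ℕ → ℝ) :
    rectDiag m n s * (rectDiag m n s)ᵀ =
      Matrix.diagonal fun i : Fin m => if (i : ℕ) < n then s (i + 1) ^ 2 else 0 := by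
  ext i j
  rw [Matrix.mul_apply, Matrix.diagonal_apply]
  by_cases hi : (i : ℕ) < n
  · rw [Finset.sum_eq_single ⟨i, hi⟩]
    · by_cases hij : i = j
      · subst hij
        simp [rectDiag, hi, sq]
      · have : ¬ (j : ℕ) = i := fun h => hij (Fin.ext h.symm)
        simp [rectDiag, hij, this]
    · intro c _ hc
      have : ¬ (i : ℕ) = c := fun h => hc (Fin.ext h.symm)
      simp [rectDiag, this]
    · simp
  · rw [Finset.sum_eq_zero]
    · simp [hi]
    · intro c _
      have : ¬ (i : ℕ) = c := by omega
      simp [rectDiag, this]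

theorem rectDiag_sub (m n : ℕ) (s t : ℕ → ℝ) :
    rectDiag m n s - rectDiag m n t = rectDiag m n fun i => s i - t i := by
  ext i j
  by_cases h : (i : ℕ) = j <;> simp [rectDiag, h]

theorem rank_rectDiag_truncate_le (m n k : ℕ) (s : ℕ → ℝ) :
    (rectDiag m n fun i => if i ≤ k then s i else 0).rank ≤ k := by
  have h : (rectDiag m n fun i => if i ≤ k then s i else 0) =
      rectDiag m k s * rectDiag k n fun _ => 1 := by
    ext i j
    rw [Matrix.mul_apply]
    by_cases hi : (i : ℕ) < k
    · rw [Finset.sum_eq_single ⟨i, hi⟩]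
      · simp [rectDiag, hi]
      · intro c _ hc
        have : ¬ (i : ℕ) = c := fun h => hc (Fin.ext h.symm)
        simp [rectDiag, this]
      · simp
    · rw [Finset.sum_eq_zero]
      · simp [rectDiag, hi]
      · intro c _
        have : ¬ (i : ℕ) = c := by omega
        simp [rectDiag, this]
  rw [h]
  exact (Matrix.rank_mul_le_left _ _).trans (Matrix.rank_le_width _)

theorem sum_fin_tail_eq_sum_Ioc (m n k : ℕ) (f : ℕ → ℝ) :
    (∑ i : Fin m, if k ≤ (i : ℕ) then (if (i : ℕ) < n then f (i + 1) else 0) else 0) =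
      ∑ i ∈ Finset.Ioc k (min m n), f i := by
  rw [Fin.sum_univ_eq_sum_range
    (fun i => if k ≤ i then (if i < n then f (i + 1) else 0) else 0) m]
  simp only [← ite_and]
  rw [← Finset.sum_filter]
  refine Finset.sum_nbij' (· + 1) (· - 1) ?_ ?_ ?_ ?_ ?_ <;>
    simp only [Finset.mem_filter, Finset.mem_range, Finset.mem_Ioc] <;> intros <;>
    first | omega | trivial

/-- Every real matrix `Y` has an orthonormal system, the columns of `Q`, of cardinality `rank Y`
such that `Q Qᵀ` fixes the columns of `Y`. -/
theorem exists_orthonormal_columns {m n : ℕ} (Y : Matrix (Fin m) (Fin n) ℝ) :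
    ∃ Q : Matrix (Fin m) (Fin Y.rank) ℝ, Qᵀ * Q = 1 ∧ Q * Qᵀ * Y = Y := by
  let S : Submodule ℝ (EuclideanSpace ℝ (Fin m)) := LinearMap.range Y.toEuclideanLin
  have hS : Module.finrank ℝ S = Y.rank := by
    rw [Matrix.rank_eq_finrank_range_toLin Y (EuclideanSpace.basisFun (Fin m) ℝ).toBasis
      (EuclideanSpace.basisFun (Fin n) ℝ).toBasis]
    rfl
  let b : OrthonormalBasis (Fin Y.rank) ℝ S :=
    (stdOrthonormalBasis ℝ S).reindex (finCongr hS)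
  clear_value b
  refine ⟨Matrix.of fun i j => (b j : EuclideanSpace ℝ (Fin m)) i, ?_, ?_⟩
  · ext i j
    have h := orthonormal_iff_ite.mp b.orthonormal i j
    rw [Submodule.coe_inner, PiLp.inner_apply] at h
    simp only [Matrix.mul_apply, Matrix.transpose_apply, Matrix.of_apply, Matrix.one_apply, ← h]
    exact Finset.sum_congr rfl fun a _ => mul_comm _ _
  · ext i j
    let y : S := ⟨Y.toEuclideanLin (EuclideanSpace.single j 1), LinearMap.mem_range_self _ _⟩
    have hy : ∀ a, (y : EuclideanSpace ℝ (Fin m)) a = Y a j := by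
      intro a
      simp [y, Matrix.toLpLin_apply]
    have h := congrArg (fun z : S => (z : EuclideanSpace ℝ (Fin m)) i) (b.sum_repr' y)
    simp only [Submodule.coe_inner, PiLp.inner_apply] at h
    rw [Matrix.mul_assoc, ← hy i, ← h]
    simp only [hy, Matrix.mul_apply, Matrix.transpose_apply, Matrix.of_apply]
    simp [mul_comm]

theorem sum_tail_le_sum_weighted {m k : ℕ} (d : ℕ → ℝ) (hd0 : ∀ i, 0 ≤ d i)
    (hd : Antitone d) (p : Fin m → ℝ) (hp0 : ∀ i, 0 ≤ p i) (hp1 : ∀ i, p i ≤ 1)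
    (hpk : ∑ i, p i ≤ k) :
    (∑ i : Fin m, if k ≤ (i : ℕ) then d i else 0) ≤ ∑ i : Fin m, (1 - p i) * d i := by
  have hpt : ∀ i : Fin m, (if (i : ℕ) < k then 1 else 0) * d k - p i * d k ≤
      (1 - p i) * d i - if k ≤ (i : ℕ) then d i else 0 := by
    intro i
    rcases lt_or_ge (i : ℕ) k with h | h
    · have := mul_le_mul_of_nonneg_left (hd h.le) (sub_nonneg.mpr (hp1 i))
      simp only [h, not_le.mpr h, if_true, if_false]
      linarith
    · have := mul_le_mul_of_nonneg_left (hd h) (hp0 i)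
      simp only [h, not_lt.mpr h, if_true, if_false]
      linarith
  rcases le_or_gt m k with hmk | hmk
  · rw [Finset.sum_eq_zero fun i _ => if_neg (by have := i.isLt; omega)]
    exact Finset.sum_nonneg fun i _ => mul_nonneg (sub_nonneg.mpr (hp1 i)) (hd0 i)
  · have hcard : (∑ i : Fin m, if (i : ℕ) < k then (1 : ℝ) else 0) = k := by
      rw [Finset.sum_boole, Fin.card_filter_val_lt, min_eq_right hmk.le]
    have hsum := Finset.sum_le_sum fun i (_ : i ∈ Finset.univ) => hpt i
    rw [Finset.sum_sub_distrib, Finset.sum_sub_distrib, ← Finset.sum_mul, ← Finset.sum_mul,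
      hcard] at hsum
    have := mul_le_mul_of_nonneg_right hpk (hd0 k)
    linarith

/-- The Eckart–Young lower bound for a rectangular diagonal matrix. -/
theorem sum_tail_le_frobSq_rectDiag_sub {m n k : ℕ} (s : ℕ → ℝ) (hs0 : ∀ i, 0 ≤ s i)
    (hs : ∀ i j, i ≤ j → s j ≤ s i) (Y : Matrix (Fin m) (Fin n) ℝ) (hY : Y.rank ≤ k) :
    ∑ i ∈ Finset.Ioc k (min m n), s i ^ 2 ≤ frobSq (rectDiag m n s - Y) := by
  obtain ⟨Q, hQ, hQY⟩ := exists_orthonormal_columns Y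
  set P := Q * Qᵀ with hP
  set D := rectDiag m n s with hD
  have hPt : Pᵀ = P := by simp [hP]
  have hPP : P * P = P := by
    rw [hP, Matrix.mul_assoc, ← Matrix.mul_assoc Qᵀ, hQ, Matrix.one_mul]
  have hRt : (1 - P)ᵀ = 1 - P := by rw [Matrix.transpose_sub, hPt, Matrix.transpose_one]
  have hRR : (1 - P) * (1 - P) = 1 - P := by
    simp [Matrix.sub_mul, Matrix.mul_sub, hPP]
  have hRY : (1 - P) * Y = 0 := by rw [Matrix.sub_mul, Matrix.one_mul, hQY, sub_self]
  have hquad : ∀ R : Matrix (Fin m) (Fin m) ℝ, Rᵀ = R → R * R = R →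
      ∀ Z : Matrix (Fin m) (Fin n) ℝ, frobSq (R * Z) = (R * (Z * Zᵀ)).trace := by
    intro R hR hR2 Z
    rw [frobSq_eq_trace, Matrix.transpose_mul, hR, ← Matrix.mul_assoc, Matrix.trace_mul_comm,
      ← Matrix.mul_assoc, ← Matrix.mul_assoc, hR2, Matrix.mul_assoc]
  have hdiag : ∀ R : Matrix (Fin m) (Fin m) ℝ, Rᵀ = R → R * R = R → ∀ i, 0 ≤ R i i := by
    intro R hR hR2 i
    have h : R i i = ∑ j, R i j * R i j := by
      conv_lhs => rw [← hR2]
      rw [Matrix.mul_apply]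
      exact Finset.sum_congr rfl fun j _ => by rw [← congrFun (congrFun hR i) j]; rfl
    rw [h]
    exact Finset.sum_nonneg fun j _ => mul_self_nonneg _
  have hpyth : frobSq (D - Y) = frobSq (P * (D - Y)) + frobSq ((1 - P) * (D - Y)) := by
    rw [hquad P hPt hPP, hquad _ hRt hRR, Matrix.sub_mul 1, Matrix.one_mul, Matrix.trace_sub,
      ← frobSq_eq_trace]
    ring
  have htrace : ∑ i, P i i ≤ k := by
    have h : P.trace = Y.rank := by
      rw [hP, Matrix.trace_mul_comm, hQ, Matrix.trace_one, Fintype.card_fin]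
    calc ∑ i, P i i = P.trace := rfl
      _ ≤ k := by rw [h]; exact_mod_cast hY
  have hweighted := sum_tail_le_sum_weighted (k := k)
    (fun i => if i < n then s (i + 1) ^ 2 else 0)
    (fun i => by positivity)
    (fun i j hij => by
      by_cases hj : j < n
      · simp only [hj, hij.trans_lt hj, if_true]
        exact pow_le_pow_left₀ (hs0 _) (hs _ _ (by omega)) 2
      · simp only [hj, if_false]
        positivity)
    (fun i => P i i) (hdiag P hPt hPP)
    (fun i => by simpa using hdiag _ hRt hRR i) htrace
  rw [sum_fin_tail_eq_sum_Ioc m n k fun i => s i ^ 2] at hweighted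
  have hres : frobSq ((1 - P) * (D - Y)) =
      ∑ i : Fin m, (1 - P i i) * (if (i : ℕ) < n then s (i + 1) ^ 2 else 0) := by
    rw [Matrix.mul_sub, hRY, sub_zero, hquad _ hRt hRR, hD, rectDiag_mul_transpose]
    simp only [Matrix.trace, Matrix.diag_apply, Matrix.mul_diagonal, Matrix.sub_apply,
      Matrix.one_apply_eq]
  rw [hpyth, hres]
  linarith [frobSq_nonneg (P * (D - Y))]

/-- The Eckart–Young lower bound in the Frobenius norm. -/
theorem IsSVD.sum_tail_le_frobSq_sub {m n k : ℕ} {M U : Matrix _ _ ℝ} {s : ℕ → ℝ}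
    {V : Matrix _ _ ℝ} (h : IsSVD m n M U s V) (X : Matrix (Fin m) (Fin n) ℝ)
    (hX : X.rank ≤ k) : ∑ i ∈ Finset.Ioc k (min m n), s i ^ 2 ≤ frobSq (M - X) := by
  have hU : U * Uᵀ = 1 := mul_eq_one_comm.mp h.orthU
  have hV : V * Vᵀ = 1 := mul_eq_one_comm.mp h.orthV
  have hXY : X = U * (Uᵀ * X * V) * Vᵀ := by
    rw [Matrix.mul_assoc Uᵀ, ← Matrix.mul_assoc U, hU, Matrix.one_mul, Matrix.mul_assoc, hV,
      Matrix.mul_one]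
  have hMX : M - X = U * (rectDiag m n s - Uᵀ * X * V) * Vᵀ := by
    rw [Matrix.mul_sub, Matrix.sub_mul, ← hXY, ← h.decomp]
  rw [hMX, frobSq_orthogonal_mul_mul h.orthU h.orthV]
  exact sum_tail_le_frobSq_rectDiag_sub s h.nonneg h.mono _
    ((Matrix.rank_mul_le_left _ _).trans ((Matrix.rank_mul_le_right _ _).trans hX))

theorem rank_svdTrunc_le (m n k : ℕ) (U : Matrix (Fin m) (Fin m) ℝ) (s : ℕ → ℝ)
    (V : Matrix (Fin n) (Fin n) ℝ) : (svdTrunc m n k U s V).rank ≤ k :=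
  (Matrix.rank_mul_le_left _ _).trans
    ((Matrix.rank_mul_le_right _ _).trans (rank_rectDiag_truncate_le m n k s))

theorem IsSVD.frobSq_sub_svdTrunc {m n k : ℕ} {M U : Matrix _ _ ℝ} {s : ℕ → ℝ}
    {V : Matrix _ _ ℝ} (h : IsSVD m n M U s V) :
    frobSq (M - svdTrunc m n k U s V) = ∑ i ∈ Finset.Ioc k (min m n), s i ^ 2 := by
  have hM : M - svdTrunc m n k U s V =
      U * rectDiag m n (fun i => s i - if i ≤ k then s i else 0) * Vᵀ := by
    rw [← rectDiag_sub, Matrix.mul_sub, Matrix.sub_mul, ← h.decomp, svdTrunc]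
  rw [hM, frobSq_orthogonal_mul_mul h.orthU h.orthV, frobSq_eq_trace, rectDiag_mul_transpose,
    Matrix.trace_diagonal, ← sum_fin_tail_eq_sum_Ioc m n k fun i => s i ^ 2]
  refine Finset.sum_congr rfl fun i _ => ?_
  rcases lt_or_ge (i : ℕ) k with hi | hi
  · simp [hi]
  · simp [hi, not_lt.mpr hi]

/-- Completing the square: the objective differs by a constant from the distance of `W' L` to
`W A Bᵀ (B Bᵀ)⁻¹ L`. -/
theorem frobSq_sub_mul_eq {m n l : ℕ} (W : Matrix (Fin m) (Fin n) ℝ)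
    (A B : Matrix (Fin n) (Fin l) ℝ) (hBB : IsUnit (B * Bᵀ).det)
    (L : Matrix (Fin n) (Fin n) ℝ) (hfac : B * Bᵀ = L * Lᵀ) (W' : Matrix (Fin m) (Fin n) ℝ) :
    frobSq (W * A - W' * B) = frobSq (W * A) - frobSq (W * A * Bᵀ * (B * Bᵀ)⁻¹ * L) +
      frobSq (W * A * Bᵀ * (B * Bᵀ)⁻¹ * L - W' * L) := by
  have hcross : W * A * Bᵀ * (B * Bᵀ)⁻¹ * L * (W' * L)ᵀ = W * A * (W' * B)ᵀ := by
    calc _ = W * A * Bᵀ * ((B * Bᵀ)⁻¹ * (L * Lᵀ)) * W'ᵀ := by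
          simp only [Matrix.transpose_mul, Matrix.mul_assoc]
      _ = _ := by
          rw [← hfac, Matrix.nonsing_inv_mul _ hBB, Matrix.mul_one, Matrix.transpose_mul,
            Matrix.mul_assoc (W * A)]
  have hsq : frobSq (W' * L) = frobSq (W' * B) := by
    simp only [frobSq_eq_trace, Matrix.transpose_mul]
    rw [Matrix.mul_assoc, ← Matrix.mul_assoc L, ← hfac, Matrix.mul_assoc W' B,
      ← Matrix.mul_assoc B]
  rw [frobSq_sub, frobSq_sub, hcross, hsq]
  ring

/-- With `M := W A Bᵀ (B Bᵀ)⁻¹ L`, the minimum of `‖W A − W' B‖_F²` over all `W'` of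
rank at most `k` equals `‖W A‖_F² − ‖M‖_F² + ∑_{i>k} σ_i(M)²`. -/
theorem anchored_lowrank_min_value {m n l k : ℕ}
    (W : Matrix (Fin m) (Fin n) ℝ) (A B : Matrix (Fin n) (Fin l) ℝ)
    (hBB : IsUnit (B * Bᵀ).det)
    (L : Matrix (Fin n) (Fin n) ℝ) (hL : IsUnit L.det) (hfac : B * Bᵀ = L * Lᵀ)
    (U : Matrix (Fin m) (Fin m) ℝ) (s : ℕ → ℝ) (V : Matrix (Fin n) (Fin n) ℝ)
    (hSVD : IsSVD m n (W * A * Bᵀ * (B * Bᵀ)⁻¹ * L) U s V) :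
    IsLeast {v : ℝ | ∃ W' : Matrix (Fin m) (Fin n) ℝ, W'.rank ≤ k ∧
        v = frobSq (W * A - W' * B)}
      (frobSq (W * A) - frobSq (W * A * Bᵀ * (B * Bᵀ)⁻¹ * L) +
        ∑ i ∈ Finset.Ioc k (min m n), s i ^ 2) := by
  refine ⟨⟨svdTrunc m n k U s V * L⁻¹, ?_, ?_⟩, ?_⟩
  · exact (Matrix.rank_mul_le_left _ _).trans (rank_svdTrunc_le m n k U s V)
  · rw [frobSq_sub_mul_eq W A B hBB L hfac, Matrix.mul_assoc (svdTrunc m n k U s V),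
      Matrix.nonsing_inv_mul _ hL, Matrix.mul_one, hSVD.frobSq_sub_svdTrunc]
  · rintro v ⟨W', hW', rfl⟩
    rw [frobSq_sub_mul_eq W A B hBB L hfac]
    gcongr
    exact hSVD.sum_tail_le_frobSq_sub _ ((Matrix.rank_mul_le_left _ _).trans hW')
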